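/- Let M be a vertically 4-connected matroid, let X be a subset of E(M) such that the restriction M|X is isomorphic to the uniform matroid U_{2,4}, and let x be an element of X. Then M \ x is vertically 4-connected. -/

import Mathlib

open Set Matroid

universe u

variable {α : Type u}

/-- The rank of a set `X` in a matroid `M`: the supremum of the cardinalities of the
independent subsets of `X`. -/
noncomputable def mrk (M : Matroid α) (X : Set α) : ℕ∞ :=
  ⨆ I ∈ {I : Set α | M.Indep I ∧ I ⊆ X}, I.encard

/-- The rank `r(M)` of a matroid `M`. -/
noncomputable def mrank (M : Matroid α) : ℕ∞ := mrk M M.E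

/-- The connectivity function `λ_M(X) = r(X) + r(E(M) - X) - r(M)`. -/
noncomputable def lam (M : Matroid α) (X : Set α) : ℕ∞ :=
  mrk M X + mrk M (M.E \ X) - mrank M

/-- The deletion `M \ D` of a set of elements `D` from `M`. -/
def mdel (M : Matroid α) (D : Set α) : Matroid α := M ↾ (M.E \ D)

/-- A circuit of a matroid: a minimal dependent set. -/
def MCircuit (M : Matroid α) (C : Set α) : Prop := M.Dep C ∧ ∀ D, D ⊂ C → M.Indep D

/-- A cocircuit of a matroid: a circuit of the dual matroid. -/
def MCocircuit (M : Matroid α) (C : Set α) : Prop := MCircuit M✶ C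

/-- A triangle: a 3-element circuit. -/
def IsTriangle (M : Matroid α) (T : Set α) : Prop := MCircuit M T ∧ T.encard = 3

/-- `(X, Y)` is a vertical `j`-separation of `M`: a partition of `E(M)` with
`λ_M(X) < j` and `min {r(X), r(Y)} ≥ j`. -/
def IsVSep (M : Matroid α) (j : ℕ) (X Y : Set α) : Prop :=
  X ∪ Y = M.E ∧ Disjoint X Y ∧ lam M X < (j : ℕ∞) ∧
    (j : ℕ∞) ≤ mrk M X ∧ (j : ℕ∞) ≤ mrk M Y

/-- An exact vertical `j`-separation: one with `λ_M(X) = j - 1`. -/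
def IsExactVSep (M : Matroid α) (j : ℕ) (X Y : Set α) : Prop :=
  IsVSep M j X Y ∧ lam M X = (j : ℕ∞) - 1

/-- `M` is vertically `k`-connected: it has no vertical `j`-separation for a
positive integer `j < k`. -/
def VertConn (M : Matroid α) (k : ℕ) : Prop :=
  ∀ j X Y, 0 < j → j < k → ¬ IsVSep M j X Y

/-- `(X, Y)` is a (Tutte) `j`-separation of `M`. -/
def IsSep (M : Matroid α) (j : ℕ) (X Y : Set α) : Prop :=
  X ∪ Y = M.E ∧ Disjoint X Y ∧ lam M X < (j : ℕ∞) ∧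
    (j : ℕ∞) ≤ X.encard ∧ (j : ℕ∞) ≤ Y.encard

/-- `M` is (Tutte) `k`-connected. -/
def TConn (M : Matroid α) (k : ℕ) : Prop :=
  ∀ j X Y, 0 < j → j < k → ¬ IsSep M j X Y

/-- `M` is minimally vertically 4-connected. -/
def MinVertConn4 (M : Matroid α) : Prop :=
  VertConn M 4 ∧ ∀ e ∈ M.E, ¬ VertConn (mdel M {e}) 4

/-- `M` is a simple matroid: every subset of the ground set with at most two
elements is independent (no loops and no parallel pairs). -/
def MSimple (M : Matroid α) : Prop := ∀ S ⊆ M.E, S.encard ≤ 2 → M.Indep S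

/-- `M` has a restriction isomorphic to `U_{2,4}`: a 4-element subset of the ground set
of rank 2, all of whose subsets with at most 2 elements are independent. -/
def HasU24Restriction (M : Matroid α) : Prop :=
  ∃ X ⊆ M.E, X.encard = 4 ∧ mrk M X = 2 ∧ ∀ S ⊆ X, S.encard ≤ 2 → M.Indep S

/-- The restriction `M|X` is isomorphic to `U_{2,4}`. -/
def RestrIsoU24 (M : Matroid α) (X : Set α) : Prop :=
  X ⊆ M.E ∧ X.encard = 4 ∧ mrk M X = 2 ∧ ∀ S ⊆ X, S.encard ≤ 2 → M.Indep S

/-- The restriction `M|C` is isomorphic to `U_{2,k} ⊕ U_{2,2}`: `C` is the disjoint union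
of a `k`-element rank-2 set `L` containing no loops or parallel pairs (a copy of `U_{2,k}`)
and a 2-element independent set `P` (a copy of `U_{2,2}`), with `r(C) = r(L) + r(P) = 4`,
so that the restriction is the direct sum of the two pieces. -/
def RestrIsoLinePlusPair (M : Matroid α) (C : Set α) (k : ℕ) : Prop :=
  ∃ L P, C = L ∪ P ∧ Disjoint L P ∧ L.encard = (k : ℕ∞) ∧ P.encard = 2 ∧
    M.Indep P ∧ mrk M L = 2 ∧ (∀ S ⊆ L, S.encard ≤ 2 → M.Indep S) ∧ mrk M C = 4

/-- The restriction `M|X` is isomorphic to the 2-sum `U_{2,4} ⊕₂ U_{2,4}`: `X` is the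
disjoint union of two 3-element circuits `T₁` and `T₂`, and the circuits of `M` contained
in `X` (i.e. the circuits of `M|X`) are exactly `T₁`, `T₂`, and the unions `P₁ ∪ P₂` of
2-element subsets `P₁ ⊆ T₁` and `P₂ ⊆ T₂`. -/
def RestrIsoTwoSumU24U24 (M : Matroid α) (X : Set α) : Prop :=
  X ⊆ M.E ∧ ∃ T₁ T₂ : Set α, Disjoint T₁ T₂ ∧ X = T₁ ∪ T₂ ∧
    T₁.encard = 3 ∧ T₂.encard = 3 ∧
    ∀ C ⊆ X, (MCircuit M C ↔ (C = T₁ ∨ C = T₂ ∨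
      ∃ P₁ P₂, P₁ ⊆ T₁ ∧ P₂ ⊆ T₂ ∧ P₁.encard = 2 ∧ P₂.encard = 2 ∧ C = P₁ ∪ P₂))

/-- The columns of the `GF(3)`-matrix representing `N₉`. -/
def N9Cols : Fin 9 → Fin 4 → ZMod 3 :=
  ![![1, 0, 0, 0], ![0, 1, 0, 0], ![0, 0, 1, 0], ![0, 0, 0, 1], ![0, 1, 1, -1],
    ![1, 0, 1, 1], ![1, 1, 0, 1], ![-1, 1, 1, 0], ![1, -1, 1, -1]]

/-- `M` is isomorphic to `N₉`, the 9-element rank-4 matroid represented over `GF(3)`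
by the matrix with columns `N9Cols`. -/
def IsoN9 (M : Matroid α) : Prop :=
  ∃ φ : α → Fin 9, Set.BijOn φ M.E Set.univ ∧
    ∀ I ⊆ M.E, (M.Indep I ↔ LinearIndependent (ZMod 3) fun x : I => N9Cols (φ x.1))

/-- `M` is binary: representable over the two-element field `GF(2)`, i.e. there is a
map from the ground set to a `GF(2)`-vector space under which independence in `M`
coincides with linear independence. -/
def IsBinary (M : Matroid α) : Prop :=
  ∃ (ι : Type u) (φ : α → ι → ZMod 2),
    ∀ I ⊆ M.E, (M.Indep I ↔ LinearIndependent (ZMod 2) fun x : I => φ x.1)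

/-- `M` is a uniform matroid, i.e. isomorphic to `U_{m,n}` for some `m` and `n`:
the ground set has `n` elements and a subset of the ground set is independent
exactly when it has at most `m` elements. -/
def IsUniform (M : Matroid α) : Prop :=
  ∃ m n : ℕ, M.E.encard = (n : ℕ∞) ∧ ∀ I ⊆ M.E, (M.Indep I ↔ I.encard ≤ (m : ℕ∞))

lemma mrk_eq_eRk (M : Matroid α) (X : Set α) : mrk M X = M.eRk X := by
  apply le_antisymm
  · refine iSup₂_le fun I hI => ?_
    rw [← hI.1.eRk_eq_encard]
    exact M.eRk_mono hI.2
  · obtain ⟨I, hI⟩ := M.exists_isBasis' X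
    rw [← hI.encard_eq_eRk]
    exact le_iSup₂_of_le I ⟨hI.indep, hI.subset⟩ le_rfl

lemma mrk_mdel (M : Matroid α) (x : α) (A : Set α) (hA : A ⊆ M.E \ {x}) :
    mrk (mdel M {x}) A = M.eRk A := by
  rw [mrk_eq_eRk, mdel, restrict_eRk_eq _ hA]

lemma key_sep (M : Matroid α) (x : α) (hx : x ∈ M.E) (A B : Set α) (j : ℕ)
    (hu : A ∪ B = M.E \ {x}) (hd : Disjoint A B)
    (hl : M.eRk A + M.eRk B - M.eRk (M.E \ {x}) < (j : ℕ∞))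
    (hA : (j : ℕ∞) ≤ M.eRk A) (hB : (j : ℕ∞) ≤ M.eRk B)
    (hc : x ∈ M.closure A) : IsVSep M j (insert x A) B := by
  have hAE : A ⊆ M.E \ {x} := hu ▸ subset_union_left
  have hBE : B ⊆ M.E \ {x} := hu ▸ subset_union_right
  have hxB : x ∉ B := fun h => (hBE h).2 rfl
  have hun : insert x A ∪ B = M.E := by
    rw [insert_union, hu, insert_sdiff_singleton, insert_eq_of_mem hx]
  have hdis : Disjoint (insert x A) B := by
    rw [disjoint_insert_left]
    exact ⟨hxB, hd⟩
  have hco : M.E \ insert x A = B := by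
    rw [← hun, union_sdiff_left, hdis.sdiff_eq_right]
  have hr : ∀ S, A ⊆ S → M.eRk (insert x S) = M.eRk S := fun S hS => by
    rw [← M.eRk_closure_eq (insert x S),
      closure_insert_eq_of_mem_closure (M.closure_subset_closure hS hc), M.eRk_closure_eq]
  have hE : M.eRk M.E = M.eRk (M.E \ {x}) := by
    rw [← hr _ hAE, insert_sdiff_singleton, insert_eq_of_mem hx]
  refine ⟨hun, hdis, ?_, ?_, ?_⟩
  · unfold lam mrank
    rw [hco, mrk_eq_eRk, mrk_eq_eRk, mrk_eq_eRk, hr A subset_rfl, hE]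
    exact hl
  · rw [mrk_eq_eRk, hr A subset_rfl]
    exact hA
  · rw [mrk_eq_eRk]
    exact hB

lemma mem_cl (M : Matroid α) (X : Set α) (hX : RestrIsoU24 M X) (x : α) (hx : x ∈ X)
    (A : Set α) (hxA : x ∉ A) (h : 1 < (X ∩ A).encard) : x ∈ M.closure A := by
  obtain ⟨a, b, ha, hb, hab⟩ := one_lt_encard_iff.1 h
  obtain ⟨hXE, -, hr, hI⟩ := hX
  have hsub : ({a, b} : Set α) ⊆ X ∩ A := by
    rintro y (rfl | rfl) <;> assumption
  have hi : M.Indep {a, b} := hI _ (hsub.trans inter_subset_left) (encard_pair hab).le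
  have hxab : x ∉ ({a, b} : Set α) := fun h => hxA (hsub h).2
  refine M.closure_subset_closure (hsub.trans inter_subset_right) ?_
  rw [hi.mem_closure_iff_of_notMem hxab, ← not_indep_iff
    (insert_subset (hXE hx) ((hsub.trans inter_subset_left).trans hXE))]
  intro hi3
  have h3 := M.eRk_mono (insert_subset hx (hsub.trans inter_subset_left))
  rw [hi3.eRk_eq_encard, encard_insert_of_notMem hxab, encard_pair hab, ← mrk_eq_eRk, hr] at h3
  exact absurd h3 (by decide)

/-- If `M` is a vertically 4-connected matroid, `X ⊆ E(M)` with `M|X ≅ U_{2,4}`, and `x ∈ X`,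
then `M \ x` is vertically 4-connected. -/
theorem statement_5 (M : Matroid α) (hM : VertConn M 4) (X : Set α)
    (hX : RestrIsoU24 M X) (x : α) (hx : x ∈ X) :
    VertConn (mdel M {x}) 4 := by
  intro j A B hj0 hj4 hs
  obtain ⟨hu, hd, hl, hA, hB⟩ := hs
  have hxE : x ∈ M.E := hX.1 hx
  change A ∪ B = M.E \ {x} at hu
  have hAE : A ⊆ M.E \ {x} := hu ▸ subset_union_left
  have hBE : B ⊆ M.E \ {x} := hu ▸ subset_union_right
  have hco : (M.E \ {x}) \ A = B := by
    rw [← hu, union_sdiff_left, hd.sdiff_eq_right]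
  have hl' : M.eRk A + M.eRk B - M.eRk (M.E \ {x}) < (j : ℕ∞) := by
    have h1 := mrk_mdel M x A hAE
    have h2 := mrk_mdel M x B hBE
    have h3 := mrk_mdel M x (M.E \ {x}) subset_rfl
    rw [← h1, ← h2, ← h3]
    rw [← hco]
    exact hl
  rw [mrk_mdel M x A hAE] at hA
  rw [mrk_mdel M x B hBE] at hB
  by_cases h1 : 1 < (X ∩ A).encard
  · exact hM j _ _ hj0 hj4 (key_sep M x hxE A B j hu hd hl' hA hB
      (mem_cl M X hX x hx A (fun h => (hAE h).2 rfl) h1))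
  by_cases h2 : 1 < (X ∩ B).encard
  · exact hM j _ _ hj0 hj4 (key_sep M x hxE B A j (by rw [union_comm, hu]) hd.symm
      (by rwa [add_comm]) hB hA
      (mem_cl M X hX x hx B (fun h => (hBE h).2 rfl) h2))
  exfalso
  have hsub : X ⊆ insert x ((X ∩ A) ∪ (X ∩ B)) := by
    intro y hy
    by_cases hyx : y = x
    · exact Or.inl hyx
    · have : y ∈ A ∪ B := hu ▸ ⟨hX.1 hy, hyx⟩
      exact Or.inr (this.imp (fun h => ⟨hy, h⟩) (fun h => ⟨hy, h⟩))
  have h4 : (4 : ℕ∞) ≤ 1 + 1 + 1 := by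
    rw [← hX.2.1]
    refine (encard_le_encard hsub).trans ((encard_insert_le _ _).trans ?_)
    gcongr
    refine (encard_union_le _ _).trans ?_
    exact add_le_add (not_lt.1 h1) (not_lt.1 h2)
  exact absurd h4 (by decide)
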